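/- (Theorem 2, first nonlinear problem: weak duality and primal recovery.) Let M_κ = S₊ᵀS₊ + c₁E₁ with c₁ > 0, which is symmetric positive definite. (i) For every (w, b, ξ) with w ∈ ℝˡ, b ∈ ℝ, ξ ∈ ℝ^{l₋} satisfying -(K₋w + e₋b) + ξ ≥ e₋ and ξ ≥ 0, and every α ∈ ℝ^{l₋} with 0 ≤ α ≤ c₃s₋, one has ⟨e₋, α⟩ - (1/2)αᵀS₋M_κ⁻¹S₋ᵀα ≤ (1/2)c₁‖w‖² + (1/2)‖K₊w + e₊b‖² + c₃⟨s₋, ξ⟩. (ii) If α* maximizes the dual objective over the box {0 ≤ α ≤ c₃s₋}, then v₊* = (w₊*, b₊*) = -M_κ⁻¹S₋ᵀα* together with ξ*ᵢ = max(0, 1 + (K₋w₊* + e₋b₊*)ᵢ) is feasible and optimal for the primal problem, with equal optimal values. -/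

import Mathlib

open Matrix

/-- The variational inequality at a maximizer of a concave quadratic, in one variable. -/
theorem nonpos_of_forall_mul_le_sq_mul {p q : ℝ} (hq : 0 ≤ q)
    (h : ∀ t : ℝ, 0 ≤ t → t ≤ 1 → t * p ≤ t ^ 2 / 2 * q) : p ≤ 0 := by
  by_contra! hp
  have hpq : 0 < p + q := by positivity
  have ht := h (p / (p + q)) (by positivity) ((div_le_one hpq).2 (by linarith))
  have hlt : p / (p + q) * p = (p / (p + q)) ^ 2 * (p + q) := by field_simp
  have hsq : 0 < (p / (p + q)) ^ 2 := by positivity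
  nlinarith [mul_nonneg hsq.le hq, mul_pos hsq hp]

section BoxDual

variable {m n : Type*} [Fintype m] [Fintype n] [DecidableEq n]
  {A : Matrix n n ℝ} (B : Matrix m n ℝ)

theorem Matrix.dotProduct_schur_mulVec (A : Matrix n n ℝ) (α β : m → ℝ) :
    α ⬝ᵥ (B * A⁻¹ * Bᵀ) *ᵥ β = (Bᵀ *ᵥ α) ⬝ᵥ (A⁻¹ *ᵥ (Bᵀ *ᵥ β)) := by
  rw [← mulVec_mulVec, ← mulVec_mulVec, dotProduct_mulVec, ← mulVec_transpose]

theorem Matrix.PosDef.dotProduct_schur_comm (hA : A.PosDef) (α β : m → ℝ) :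
    α ⬝ᵥ (B * A⁻¹ * Bᵀ) *ᵥ β = β ⬝ᵥ (B * A⁻¹ * Bᵀ) *ᵥ α := by
  have hsymm : (B * A⁻¹ * Bᵀ)ᵀ = B * A⁻¹ * Bᵀ := by
    have hAt : Aᵀ = A := by simpa [conjTranspose_eq_transpose_of_trivial] using hA.isHermitian.eq
    rw [transpose_mul, transpose_mul, transpose_transpose, transpose_nonsing_inv, hAt,
      Matrix.mul_assoc]
  rw [dotProduct_mulVec, ← mulVec_transpose, hsymm, dotProduct_comm]

theorem Matrix.PosDef.mulVec_inv_mulVec (hA : A.PosDef) (u : n → ℝ) : A *ᵥ (A⁻¹ *ᵥ u) = u := by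
  rw [mulVec_mulVec, mul_nonsing_inv _ ((isUnit_iff_isUnit_det A).1 hA.isUnit), one_mulVec]

theorem Matrix.PosDef.inv_mulVec_quadratic (hA : A.PosDef) (α : m → ℝ) :
    (-(A⁻¹ *ᵥ (Bᵀ *ᵥ α))) ⬝ᵥ A *ᵥ (-(A⁻¹ *ᵥ (Bᵀ *ᵥ α))) = α ⬝ᵥ (B * A⁻¹ * Bᵀ) *ᵥ α := by
  rw [dotProduct_schur_mulVec, mulVec_neg, hA.mulVec_inv_mulVec, neg_dotProduct_neg,
    dotProduct_comm]

theorem Matrix.PosDef.schur_nonneg (hA : A.PosDef) (α : m → ℝ) :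
    0 ≤ α ⬝ᵥ (B * A⁻¹ * Bᵀ) *ᵥ α := by
  rw [← hA.inv_mulVec_quadratic]
  simpa using hA.posSemidef.dotProduct_mulVec_nonneg (-(A⁻¹ *ᵥ (Bᵀ *ᵥ α)))

/-- Fenchel–Young inequality for the quadratic form of `A`. -/
theorem Matrix.PosDef.neg_schur_le (hA : A.PosDef) (v : n → ℝ) (α : m → ℝ) :
    -(1 / 2) * (α ⬝ᵥ (B * A⁻¹ * Bᵀ) *ᵥ α) ≤ (1 / 2) * (v ⬝ᵥ A *ᵥ v) + α ⬝ᵥ B *ᵥ v := by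
  have h : 0 ≤ (v + A⁻¹ *ᵥ (Bᵀ *ᵥ α)) ⬝ᵥ A *ᵥ (v + A⁻¹ *ᵥ (Bᵀ *ᵥ α)) := by
    simpa using hA.posSemidef.dotProduct_mulVec_nonneg (v + A⁻¹ *ᵥ (Bᵀ *ᵥ α))
  have hAt : Aᵀ = A := by simpa [conjTranspose_eq_transpose_of_trivial] using hA.isHermitian.eq
  have hcross : (A⁻¹ *ᵥ (Bᵀ *ᵥ α)) ⬝ᵥ A *ᵥ v = α ⬝ᵥ B *ᵥ v := by
    rw [dotProduct_mulVec, ← mulVec_transpose, hAt, hA.mulVec_inv_mulVec, mulVec_transpose,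
      ← dotProduct_mulVec]
  have hcross' : v ⬝ᵥ (Bᵀ *ᵥ α) = α ⬝ᵥ B *ᵥ v := by
    rw [mulVec_transpose, dotProduct_comm, ← dotProduct_mulVec]
  have hquad : (A⁻¹ *ᵥ (Bᵀ *ᵥ α)) ⬝ᵥ (Bᵀ *ᵥ α) = α ⬝ᵥ (B * A⁻¹ * Bᵀ) *ᵥ α := by
    rw [dotProduct_schur_mulVec, dotProduct_comm]
  rw [mulVec_add, hA.mulVec_inv_mulVec, add_dotProduct, dotProduct_add, dotProduct_add, hcross,
    hcross', hquad] at h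
  linarith

theorem Matrix.PosDef.box_weak_duality (hA : A.PosDef) {C : m → ℝ} {v : n → ℝ} {ξ α : m → ℝ}
    (hξ : ∀ i, -(B *ᵥ v) i + ξ i ≥ 1) (hξ0 : ∀ i, 0 ≤ ξ i) (hα : ∀ i, 0 ≤ α i ∧ α i ≤ C i) :
    (fun _ => (1 : ℝ)) ⬝ᵥ α - (1 / 2) * (α ⬝ᵥ (B * A⁻¹ * Bᵀ) *ᵥ α)
      ≤ (1 / 2) * (v ⬝ᵥ A *ᵥ v) + C ⬝ᵥ ξ := by
  have h := hA.neg_schur_le B v α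
  have hsum : (fun _ => (1 : ℝ)) ⬝ᵥ α + α ⬝ᵥ B *ᵥ v ≤ C ⬝ᵥ ξ := by
    simp only [dotProduct, ← Finset.sum_add_distrib]
    refine Finset.sum_le_sum fun i _ => ?_
    nlinarith [mul_le_mul_of_nonneg_left (hξ i) (hα i).1,
      mul_le_mul_of_nonneg_right (hα i).2 (hξ0 i)]
  linarith

theorem Matrix.PosDef.box_dual_variational (hA : A.PosDef) {C α β : m → ℝ}
    (hα : ∀ i, 0 ≤ α i ∧ α i ≤ C i)
    (hmax : ∀ γ : m → ℝ, (∀ i, 0 ≤ γ i ∧ γ i ≤ C i) →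
      (fun _ => (1 : ℝ)) ⬝ᵥ γ - (1 / 2) * (γ ⬝ᵥ (B * A⁻¹ * Bᵀ) *ᵥ γ)
        ≤ (fun _ => (1 : ℝ)) ⬝ᵥ α - (1 / 2) * (α ⬝ᵥ (B * A⁻¹ * Bᵀ) *ᵥ α))
    (hβ : ∀ i, 0 ≤ β i ∧ β i ≤ C i) :
    (fun _ => (1 : ℝ)) ⬝ᵥ (β - α) - (β - α) ⬝ᵥ (B * A⁻¹ * Bᵀ) *ᵥ α ≤ 0 := by
  refine nonpos_of_forall_mul_le_sq_mul (hA.schur_nonneg B (β - α)) fun t ht0 ht1 => ?_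
  have h := hmax (α + t • (β - α)) fun i => by
    simp only [Pi.add_apply, Pi.smul_apply, Pi.sub_apply, smul_eq_mul]
    constructor <;> nlinarith [hα i, hβ i, mul_nonneg ht0 (hβ i).1,
      mul_nonneg (sub_nonneg.2 ht1) (hα i).1, mul_le_mul_of_nonneg_left (hβ i).2 ht0,
      mul_le_mul_of_nonneg_left (hα i).2 (sub_nonneg.2 ht1)]
  have hcomm := hA.dotProduct_schur_comm B α (β - α)
  simp only [mulVec_add, mulVec_smul, add_dotProduct, dotProduct_add, smul_dotProduct,
    dotProduct_smul, smul_eq_mul] at h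
  rw [hcomm] at h
  linarith

theorem Matrix.PosDef.box_primal_le_dual (hA : A.PosDef) {C α : m → ℝ}
    (hα : ∀ i, 0 ≤ α i ∧ α i ≤ C i)
    (hmax : ∀ γ : m → ℝ, (∀ i, 0 ≤ γ i ∧ γ i ≤ C i) →
      (fun _ => (1 : ℝ)) ⬝ᵥ γ - (1 / 2) * (γ ⬝ᵥ (B * A⁻¹ * Bᵀ) *ᵥ γ)
        ≤ (fun _ => (1 : ℝ)) ⬝ᵥ α - (1 / 2) * (α ⬝ᵥ (B * A⁻¹ * Bᵀ) *ᵥ α))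
    {v : n → ℝ} (hv : v = -(A⁻¹ *ᵥ (Bᵀ *ᵥ α))) :
    (1 / 2) * (v ⬝ᵥ A *ᵥ v) + C ⬝ᵥ (fun i => max 0 (1 + (B *ᵥ v) i))
      ≤ (fun _ => (1 : ℝ)) ⬝ᵥ α - (1 / 2) * (α ⬝ᵥ (B * A⁻¹ * Bᵀ) *ᵥ α) := by
  have hBv : B *ᵥ v = -((B * A⁻¹ * Bᵀ) *ᵥ α) := by
    rw [hv, mulVec_neg, ← mulVec_mulVec, ← mulVec_mulVec]
  have hquad : v ⬝ᵥ A *ᵥ v = α ⬝ᵥ (B * A⁻¹ * Bᵀ) *ᵥ α := by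
    rw [hv, hA.inv_mulVec_quadratic]
  have hvar := hA.box_dual_variational B hα hmax
    (β := fun i => if 0 < 1 + (B *ᵥ v) i then C i else 0) fun i => by
      have := hα i
      split_ifs <;> constructor <;> linarith
  have hslack : C ⬝ᵥ (fun i => max 0 (1 + (B *ᵥ v) i))
      = (fun _ => (1 : ℝ)) ⬝ᵥ (fun i => if 0 < 1 + (B *ᵥ v) i then C i else 0)
        + (fun i => if 0 < 1 + (B *ᵥ v) i then C i else 0) ⬝ᵥ (B *ᵥ v) := by
    simp only [dotProduct, ← Finset.sum_add_distrib]
    refine Finset.sum_congr rfl fun i _ => ?_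
    split_ifs with h
    · rw [max_eq_right h.le]; ring
    · rw [max_eq_left (not_lt.1 h)]; ring
  rw [hslack, hquad]
  have hQ : (B * A⁻¹ * Bᵀ) *ᵥ α = -(B *ᵥ v) := by rw [hBv, neg_neg]
  rw [hQ] at hvar ⊢
  simp only [dotProduct_sub, sub_dotProduct, dotProduct_neg] at hvar ⊢
  linarith

end BoxDual

theorem Matrix.of_snoc_one_mulVec {m : Type*} {l : ℕ} (K : Matrix m (Fin l) ℝ)
    (v : Fin (l + 1) → ℝ) :
    (Matrix.of fun i => (Fin.snoc (K i) 1 : Fin (l + 1) → ℝ)) *ᵥ v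
      = K *ᵥ (Fin.init v : Fin l → ℝ) + v (Fin.last l) • (fun _ : m => (1 : ℝ)) := by
  ext i
  simp [mulVec, dotProduct, Fin.sum_univ_castSucc, Fin.init]

theorem regularized_gram_quadratic {m : Type*} [Fintype m] {l : ℕ} (K : Matrix m (Fin l) ℝ)
    (c : ℝ) (v : Fin (l + 1) → ℝ) :
    v ⬝ᵥ ((Matrix.of fun i => (Fin.snoc (K i) 1 : Fin (l + 1) → ℝ))ᵀ
          * (Matrix.of fun i => (Fin.snoc (K i) 1 : Fin (l + 1) → ℝ))
        + c • Matrix.diagonal (Fin.snoc (fun _ : Fin l => (1 : ℝ)) 0 : Fin (l + 1) → ℝ)) *ᵥ v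
      = c * ((Fin.init v : Fin l → ℝ) ⬝ᵥ (Fin.init v : Fin l → ℝ))
        + (K *ᵥ (Fin.init v : Fin l → ℝ) + v (Fin.last l) • (fun _ : m => (1 : ℝ)))
          ⬝ᵥ (K *ᵥ (Fin.init v : Fin l → ℝ) + v (Fin.last l) • (fun _ : m => (1 : ℝ))) := by
  rw [← of_snoc_one_mulVec, add_mulVec, dotProduct_add, ← mulVec_mulVec, dotProduct_mulVec,
    vecMul_transpose, smul_mulVec, dotProduct_smul, smul_eq_mul, add_comm]
  congr 2
  simp [dotProduct, mulVec_diagonal, Fin.sum_univ_castSucc, Fin.init]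

theorem regularized_gram_posDef {m : Type*} [Fintype m] [Nonempty m] {l : ℕ}
    (K : Matrix m (Fin l) ℝ) {c : ℝ} (hc : 0 < c) :
    ((Matrix.of fun i => (Fin.snoc (K i) 1 : Fin (l + 1) → ℝ))ᵀ
          * (Matrix.of fun i => (Fin.snoc (K i) 1 : Fin (l + 1) → ℝ))
        + c • Matrix.diagonal
          (Fin.snoc (fun _ : Fin l => (1 : ℝ)) 0 : Fin (l + 1) → ℝ)).PosDef := by
  refine PosDef.of_dotProduct_mulVec_pos ?_ fun v hv => ?_
  · rw [IsHermitian, conjTranspose_eq_transpose_of_trivial]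
    simp [transpose_mul]
  rw [star_trivial, regularized_gram_quadratic]
  have hww := dotProduct_self_star_nonneg (Fin.init v : Fin l → ℝ)
  have hrr := dotProduct_self_star_nonneg
    (K *ᵥ (Fin.init v : Fin l → ℝ) + v (Fin.last l) • (fun _ : m => (1 : ℝ)))
  rw [star_trivial] at hww hrr
  by_cases hw : (Fin.init v : Fin l → ℝ) = 0
  · have hb : v (Fin.last l) ≠ 0 := fun hb => hv <| by
      ext i
      refine Fin.lastCases hb (fun j => congrFun hw j) i
    have hcard : (0 : ℝ) < Fintype.card m := by exact_mod_cast Fintype.card_pos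
    have hsq : 0 < v (Fin.last l) * v (Fin.last l) := mul_self_pos.2 hb
    simpa [hw, dotProduct] using mul_pos hcard hsq
  · have hw_pos := hww.lt_of_ne fun h => hw (dotProduct_self_eq_zero.1 h.symm)
    have := mul_pos hc hw_pos
    linarith

/-- Theorem 2, first nonlinear problem: with kernel matrices `K₊, K₋` built from a kernel `κ`,
`M_κ = S₊ᵀS₊ + c₁E₁` is symmetric positive definite; (i) weak duality holds between the first
nonlinear FR-TSVM primal problem and its dual; (ii) if `α*` maximizes the dual objective over
the box `0 ≤ α ≤ c₃s₋`, then `v₊* = (w₊*, b₊*) = -M_κ⁻¹S₋ᵀα*` together with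
`ξ*ᵢ = max(0, 1 + (K₋w₊* + e₋b₊*)ᵢ)` is feasible and optimal for the primal problem, with
equal optimal values. -/
theorem frtsvm_nonlinear_first_problem {n l lp lm : ℕ} (hlp : 1 ≤ lp) (hlm : 1 ≤ lm)
    (x : Fin l → (Fin n → ℝ)) (xp : Fin lp → (Fin n → ℝ)) (xm : Fin lm → (Fin n → ℝ))
    (κ : (Fin n → ℝ) → (Fin n → ℝ) → ℝ)
    (c₁ c₃ : ℝ) (hc₁ : 0 < c₁) (hc₃ : 0 < c₃)
    (s : Fin lm → ℝ) (hs : ∀ i, 0 < s i) :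
    let Kp : Matrix (Fin lp) (Fin l) ℝ := Matrix.of fun i j => κ (xp i) (x j)
    let Km : Matrix (Fin lm) (Fin l) ℝ := Matrix.of fun i j => κ (xm i) (x j)
    let Sp : Matrix (Fin lp) (Fin (l + 1)) ℝ := Matrix.of fun i => Fin.snoc (Kp i) 1
    let Sm : Matrix (Fin lm) (Fin (l + 1)) ℝ := Matrix.of fun i => Fin.snoc (Km i) 1
    let E₁ : Matrix (Fin (l + 1)) (Fin (l + 1)) ℝ :=
      Matrix.diagonal (Fin.snoc (fun _ : Fin l => (1 : ℝ)) 0)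
    let Mκ := Spᵀ * Sp + c₁ • E₁
    let dual : (Fin lm → ℝ) → ℝ := fun α =>
      (fun _ : Fin lm => (1 : ℝ)) ⬝ᵥ α - (1 / 2) * (α ⬝ᵥ (Sm * Mκ⁻¹ * Smᵀ) *ᵥ α)
    let primal : (Fin l → ℝ) → ℝ → (Fin lm → ℝ) → ℝ := fun w b ξ =>
      (1 / 2) * c₁ * (w ⬝ᵥ w)
        + (1 / 2) * ((Kp *ᵥ w + b • (fun _ : Fin lp => (1 : ℝ)))
            ⬝ᵥ (Kp *ᵥ w + b • (fun _ : Fin lp => (1 : ℝ))))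
        + c₃ * (s ⬝ᵥ ξ)
    Mκ.PosDef ∧
    (∀ (w : Fin l → ℝ) (b : ℝ) (ξ : Fin lm → ℝ),
        (∀ i, -((Km *ᵥ w) i + b) + ξ i ≥ 1) → (∀ i, 0 ≤ ξ i) →
        ∀ α : Fin lm → ℝ, (∀ i, 0 ≤ α i ∧ α i ≤ c₃ * s i) →
        dual α ≤ primal w b ξ) ∧
    (∀ αs : Fin lm → ℝ,
      (∀ i, 0 ≤ αs i ∧ αs i ≤ c₃ * s i) →
      (∀ α : Fin lm → ℝ, (∀ i, 0 ≤ α i ∧ α i ≤ c₃ * s i) → dual α ≤ dual αs) →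
      let vstar : Fin (l + 1) → ℝ := -(Mκ⁻¹ *ᵥ (Smᵀ *ᵥ αs))
      let wstar : Fin l → ℝ := Fin.init vstar
      let bstar : ℝ := vstar (Fin.last l)
      let ξstar : Fin lm → ℝ := fun i => max 0 (1 + ((Km *ᵥ wstar) i + bstar))
      (∀ i, -((Km *ᵥ wstar) i + bstar) + ξstar i ≥ 1 ∧ 0 ≤ ξstar i) ∧
      (∀ (w : Fin l → ℝ) (b : ℝ) (ξ : Fin lm → ℝ),
          (∀ i, -((Km *ᵥ w) i + b) + ξ i ≥ 1 ∧ 0 ≤ ξ i) →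
          primal wstar bstar ξstar ≤ primal w b ξ) ∧
      primal wstar bstar ξstar = dual αs) := by
  intro Kp Km Sp Sm E₁ Mκ dual primal
  have : Nonempty (Fin lp) := ⟨⟨0, hlp⟩⟩
  have hM : Mκ.PosDef := regularized_gram_posDef Kp hc₁
  have hprimal (v : Fin (l + 1) → ℝ) (ξ : Fin lm → ℝ) :
      primal (Fin.init v) (v (Fin.last l)) ξ
        = (1 / 2) * (v ⬝ᵥ Mκ *ᵥ v) + (c₃ • s) ⬝ᵥ ξ := by
    have h : v ⬝ᵥ Mκ *ᵥ v = _ := regularized_gram_quadratic Kp c₁ v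
    rw [h, smul_dotProduct, smul_eq_mul]
    simp only [primal]
    ring
  have hSm (v : Fin (l + 1) → ℝ) (i : Fin lm) :
      (Sm *ᵥ v) i = (Km *ᵥ (Fin.init v : Fin l → ℝ)) i + v (Fin.last l) := by
    have h : Sm *ᵥ v = _ := of_snoc_one_mulVec Km v
    simp [h]
  have hweak (w : Fin l → ℝ) (b : ℝ) (ξ : Fin lm → ℝ)
      (hξ : ∀ i, -((Km *ᵥ w) i + b) + ξ i ≥ 1) (hξ0 : ∀ i, 0 ≤ ξ i)
      (α : Fin lm → ℝ) (hα : ∀ i, 0 ≤ α i ∧ α i ≤ c₃ * s i) : dual α ≤ primal w b ξ := by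
    have hp := hprimal (Fin.snoc w b) ξ
    have hS := hSm (Fin.snoc w b)
    simp only [Fin.init_snoc, Fin.snoc_last] at hp hS
    rw [hp]
    exact hM.box_weak_duality Sm (fun i => by rw [hS]; exact hξ i) hξ0 hα
  refine ⟨hM, hweak, fun αs hαs hmax => ?_⟩
  intro vstar wstar bstar ξstar
  have hfeas (i : Fin lm) : -((Km *ᵥ wstar) i + bstar) + ξstar i ≥ 1 ∧ 0 ≤ ξstar i :=
    ⟨by linarith [le_max_right 0 (1 + ((Km *ᵥ wstar) i + bstar))], le_max_left _ _⟩
  have hle : primal wstar bstar ξstar ≤ dual αs := by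
    have hξ : ξstar = fun i => max 0 (1 + (Sm *ᵥ vstar) i) := by
      funext i
      rw [hSm]
    have hp : primal wstar bstar ξstar = _ := hprimal vstar ξstar
    rw [hp, hξ]
    exact hM.box_primal_le_dual Sm (C := c₃ • s) hαs hmax rfl
  refine ⟨hfeas, fun w b ξ h => ?_, ?_⟩
  · exact hle.trans (hweak w b ξ (fun i => (h i).1) (fun i => (h i).2) αs hαs)
  · exact hle.antisymm
      (hweak wstar bstar ξstar (fun i => (hfeas i).1) (fun i => (hfeas i).2) αs hαs)
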